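/- arXiv:1901.05312 — 4 statements merged into one kernel-verified Lean document; each statement's English description precedes it below -/
import Mathlib

section
/- If r + s + t ≠ 1, then for every natural number n, Σ_{i=0}^{n} V_i = (V_{n+2} + (1−r)·V_{n+1} + t·V_n + (r+s−1)·V_0 + (r−1)·V_1 − V_2)/(r + s + t − 1). -/
theorem generalized_tribonacci_sum
    (r s t : ℝ) (V : ℕ → ℝ)
    (hV : ∀ n : ℕ, 3 ≤ n → V n = r * V (n - 1) + s * V (n - 2) + t * V (n - 3))
    (h : r + s + t ≠ 1) :
    ∀ n : ℕ, ∑ i ∈ Finset.range (n + 1), V i =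
      (V (n + 2) + (1 - r) * V (n + 1) + t * V n
        + (r + s - 1) * V 0 + (r - 1) * V 1 - V 2) / (r + s + t - 1) := by
  have hd : r + s + t - 1 ≠ 0 := sub_ne_zero.mpr h
  intro n
  rw [eq_div_iff hd]
  induction n with
  | zero => simp; ring
  | succ k ih =>
    have h3 : V (k + 3) = r * V (k + 2) + s * V (k + 1) + t * V k := hV (k + 3) (by omega)
    rw [Finset.sum_range_succ, add_mul, ih, show k + 1 + 2 = k + 3 from rfl,
      show k + 1 + 1 = k + 2 from rfl, h3]
    ring
end

section
/- Assume ε := r + s + t − 1 ≠ 0, and set μ := (r+s−1)·V_0 + (r−1)·V_1 − V_2 and φ : Fin 16 → ℝ by φ_j = μ − ε·(Σ_{i=0}^{j−1} V_i). Then for every natural number n, Σ_{i=0}^{n} V̂_i = (V̂_{n+2} + (1−r)·V̂_{n+1} + t·V̂_n + φ)/ε, an identity of vectors in Fin 16 → ℝ. -/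
theorem generalized_tribonacci_sedenion_sum
    (r s t : ℝ) (ht : t ≠ 0) (V : ℤ → ℝ)
    (hV : ∀ n : ℤ, V n = r * V (n - 1) + s * V (n - 2) + t * V (n - 3))
    (Vhat : ℤ → Fin 16 → ℝ)
    (hVhat : ∀ n : ℤ, ∀ i : Fin 16, Vhat n i = V (n + (i : ℕ)))
    (ε : ℝ) (hε : ε = r + s + t - 1) (hε0 : ε ≠ 0)
    (μ : ℝ) (hμ : μ = (r + s - 1) * V 0 + (r - 1) * V 1 - V 2)
    (φ : Fin 16 → ℝ)
    (hφ : ∀ j : Fin 16, φ j = μ - ε * ∑ i ∈ Finset.range (j : ℕ), V i) :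
    ∀ n : ℕ, ∑ i ∈ Finset.range (n + 1), Vhat i =
      ε⁻¹ • (Vhat (n + 2) + (1 - r) • Vhat (n + 1) + t • Vhat n + φ) := by
  have key : ∀ m : ℕ, ε * ∑ i ∈ Finset.range (m + 1), V i =
      V (m + 2) + (1 - r) * V (m + 1) + t * V m + μ := by
    intro m
    induction m with
    | zero => simp [hε, hμ]; ring
    | succ k ih =>
      rw [Finset.sum_range_succ, mul_add, ih]
      have h := hV ((k : ℤ) + 3)
      rw [show (k : ℤ) + 3 - 1 = k + 2 by ring, show (k : ℤ) + 3 - 2 = k + 1 by ring,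
        show (k : ℤ) + 3 - 3 = k by ring] at h
      push_cast
      rw [show (k : ℤ) + 1 + 2 = k + 3 by ring, show (k : ℤ) + 1 + 1 = k + 2 by ring, h, hε]
      ring
  intro n
  funext j
  have hs : ∑ i ∈ Finset.range (n + 1), V ((i : ℤ) + (j : ℕ)) =
      ∑ i ∈ Finset.range ((j : ℕ) + n + 1), V i - ∑ i ∈ Finset.range (j : ℕ), V i := by
    rw [add_assoc, Finset.sum_range_add _ (j : ℕ) (n + 1), add_sub_cancel_left]
    refine Finset.sum_congr rfl fun i _ => ?_
    push_cast
    rw [add_comm]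
  have hk := key ((j : ℕ) + n)
  push_cast at hk
  simp only [Finset.sum_apply, Pi.smul_apply, Pi.add_apply, smul_eq_mul, hVhat, hφ]
  rw [hs, eq_inv_mul_iff_mul_eq₀ hε0, mul_sub, hk,
    show (n : ℤ) + 2 + ((j : ℕ) : ℤ) = (j : ℕ) + n + 2 by ring,
    show (n : ℤ) + 1 + ((j : ℕ) : ℤ) = (j : ℕ) + n + 1 by ring,
    show (n : ℤ) + ((j : ℕ) : ℤ) = (j : ℕ) + n by ring]
  ring
end

section
/- Set ψ := (α−β)(α−γ)(β−γ), α̃ := Σ_{i=0}^{15} α^{2i}, β̃ := Σ_{i=0}^{15} β^{2i}, γ̃ := Σ_{i=0}^{15} γ^{2i}, and (αβ)~ := Σ_{i=0}^{15} (αβ)^i, (αγ)~ := Σ_{i=0}^{15} (αγ)^i, (βγ)~ := Σ_{i=0}^{15} (βγ)^i. Then for every integer n, ψ²·(Σ_{i=0}^{15} V_{n+i}²) = (β−γ)²·P²·α̃·α^{2n} + (γ−α)²·Q²·β̃·β^{2n} + (α−β)²·R²·γ̃·γ^{2n} + 2(β−γ)(γ−α)·P·Q·(αβ)~·(αβ)^n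 + 2(β−γ)(α−β)·P·R·(αγ)~·(αγ)^n + 2(γ−α)(α−β)·Q·R·(βγ)~·(βγ)^n. (This computes ψ² times the squared norm ‖V̂_n‖² = Σ_{i=0}^{15} V_{n+i}² of the n-th generalized Tribonacci sedenion.) -/
/-- A first-order recurrence on the integers with nonzero ratio is geometric. -/
lemma geom_of_rec (a : ℂ) (ha : a ≠ 0) (W : ℤ → ℂ) (h : ∀ n, W (n + 1) = a * W n) (n : ℤ) :
    W n = W 0 * a ^ n := by
  induction n using Int.induction_on with
  | zero => simp
  | succ k ih => rw [h, ih, zpow_add_one₀ ha]; ring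
  | pred k ih =>
    have h1 := h (-(k : ℤ) - 1)
    rw [sub_add_cancel, ih] at h1
    rw [zpow_sub_one₀ ha]
    field_simp
    linear_combination -h1

/-- Removing two of the roots from the recurrence leaves a geometric sequence. -/
lemma reduced_geom (V : ℤ → ℂ) (a b c : ℂ) (ha : a ≠ 0)
    (h : ∀ n, V (n + 3) = (a + b + c) * V (n + 2) - (a * b + a * c + b * c) * V (n + 1)
      + a * b * c * V n) (n : ℤ) :
    V (n + 2) - (b + c) * V (n + 1) + b * c * V n
      = (V 2 - (b + c) * V 1 + b * c * V 0) * a ^ n := by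
  have := geom_of_rec a ha (fun n => V (n + 2) - (b + c) * V (n + 1) + b * c * V n) (by
    intro n
    have e1 : n + 1 + 2 = n + 3 := by ring
    have e2 : n + 1 + 1 = n + 2 := by ring
    simp only [e1, e2, h n]
    ring) n
  simpa using this

theorem generalized_tribonacci_sedenion_norm
    (r s t : ℂ) (ht : t ≠ 0) (V : ℤ → ℂ)
    (hV : ∀ n : ℤ, V n = r * V (n - 1) + s * V (n - 2) + t * V (n - 3))
    (α β γ : ℂ)
    (hα : α ^ 3 - r * α ^ 2 - s * α - t = 0)
    (hβ : β ^ 3 - r * β ^ 2 - s * β - t = 0)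
    (hγ : γ ^ 3 - r * γ ^ 2 - s * γ - t = 0)
    (hαβ : α ≠ β) (hαγ : α ≠ γ) (hβγ : β ≠ γ)
    (hsum : α + β + γ = r)
    (hsum2 : α * β + α * γ + β * γ = -s)
    (hprod : α * β * γ = t)
    (P Q R : ℂ)
    (hP : P = V 2 - (β + γ) * V 1 + β * γ * V 0)
    (hQ : Q = V 2 - (α + γ) * V 1 + α * γ * V 0)
    (hR : R = V 2 - (α + β) * V 1 + α * β * V 0)
    (ψ : ℂ) (hψ : ψ = (α - β) * (α - γ) * (β - γ))
    (αt βt γt αβt αγt βγt : ℂ)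
    (hαt : αt = ∑ i ∈ Finset.range 16, α ^ (2 * i))
    (hβt : βt = ∑ i ∈ Finset.range 16, β ^ (2 * i))
    (hγt : γt = ∑ i ∈ Finset.range 16, γ ^ (2 * i))
    (hαβt : αβt = ∑ i ∈ Finset.range 16, (α * β) ^ i)
    (hαγt : αγt = ∑ i ∈ Finset.range 16, (α * γ) ^ i)
    (hβγt : βγt = ∑ i ∈ Finset.range 16, (β * γ) ^ i) :
    ∀ n : ℤ, ψ ^ 2 * (∑ i ∈ Finset.range 16, (V (n + i)) ^ 2) =
      (β - γ) ^ 2 * P ^ 2 * αt * α ^ (2 * n)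
      + (γ - α) ^ 2 * Q ^ 2 * βt * β ^ (2 * n)
      + (α - β) ^ 2 * R ^ 2 * γt * γ ^ (2 * n)
      + 2 * (β - γ) * (γ - α) * P * Q * αβt * (α * β) ^ n
      + 2 * (β - γ) * (α - β) * P * R * αγt * (α * γ) ^ n
      + 2 * (γ - α) * (α - β) * Q * R * βγt * (β * γ) ^ n := by
  intro n
  have h3 : ∀ n, V (n + 3) = (α + β + γ) * V (n + 2) - (α * β + α * γ + β * γ) * V (n + 1)
      + α * β * γ * V n := by
    intro n
    have h := hV (n + 3)
    rw [show n + 3 - 1 = n + 2 by ring, show n + 3 - 2 = n + 1 by ring,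
      show n + 3 - 3 = n by ring] at h
    rw [h, hsum, hsum2, hprod]
    ring
  have hne : α * β * γ ≠ 0 := by rw [hprod]; exact ht
  have hγ0 : γ ≠ 0 := right_ne_zero_of_mul hne
  have hβ0 : β ≠ 0 := right_ne_zero_of_mul (left_ne_zero_of_mul hne)
  have hα0 : α ≠ 0 := left_ne_zero_of_mul (left_ne_zero_of_mul hne)
  have binet : ∀ m, ψ * V m = (β - γ) * P * α ^ m + (γ - α) * Q * β ^ m
      + (α - β) * R * γ ^ m := by
    intro m
    have h1 := reduced_geom V α β γ hα0 h3 m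
    have h2 := reduced_geom V β α γ hβ0 (fun n => by rw [h3 n]; ring) m
    have h4 := reduced_geom V γ α β hγ0 (fun n => by rw [h3 n]; ring) m
    rw [← hP] at h1
    rw [← hQ] at h2
    rw [← hR] at h4
    rw [hψ]
    linear_combination (β - γ) * h1 + (γ - α) * h2 + (α - β) * h4
  rw [hαt, hβt, hγt, hαβt, hαγt, hβγt]
  simp only [Finset.mul_sum, Finset.sum_mul, ← Finset.sum_add_distrib]
  refine Finset.sum_congr rfl fun i _ => ?_
  rw [← mul_pow, binet, zpow_add₀ hα0, zpow_add₀ hβ0, zpow_add₀ hγ0]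
  simp only [zpow_natCast, mul_zpow, mul_pow, two_mul, zpow_add₀ hα0, zpow_add₀ hβ0,
    zpow_add₀ hγ0, pow_add]
  ring
end

section
/- For every natural number n, Σ_{i=0}^{n} C(n,i)·V_i = P·(1+α)^n/((α−β)(α−γ)) + Q·(1+β)^n/((β−α)(β−γ)) + R·(1+γ)^n/((γ−α)(γ−β)), where C(n,i) denotes the binomial coefficient. -/
theorem generalized_tribonacci_binomial_sum
    (r s t : ℂ) (ht : t ≠ 0) (V : ℤ → ℂ)
    (hV : ∀ n : ℤ, V n = r * V (n - 1) + s * V (n - 2) + t * V (n - 3))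
    (α β γ : ℂ)
    (hα : α ^ 3 - r * α ^ 2 - s * α - t = 0)
    (hβ : β ^ 3 - r * β ^ 2 - s * β - t = 0)
    (hγ : γ ^ 3 - r * γ ^ 2 - s * γ - t = 0)
    (hαβ : α ≠ β) (hαγ : α ≠ γ) (hβγ : β ≠ γ)
    (hsum : α + β + γ = r)
    (hsum2 : α * β + α * γ + β * γ = -s)
    (hprod : α * β * γ = t)
    (P Q R : ℂ)
    (hP : P = V 2 - (β + γ) * V 1 + β * γ * V 0)
    (hQ : Q = V 2 - (α + γ) * V 1 + α * γ * V 0)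
    (hR : R = V 2 - (α + β) * V 1 + α * β * V 0) :
    ∀ n : ℕ, ∑ i ∈ Finset.range (n + 1), (n.choose i : ℂ) * V i =
      P * (1 + α) ^ n / ((α - β) * (α - γ))
      + Q * (1 + β) ^ n / ((β - α) * (β - γ))
      + R * (1 + γ) ^ n / ((γ - α) * (γ - β)) := by
  have h1 : α - β ≠ 0 := sub_ne_zero.mpr hαβ
  have h2 : α - γ ≠ 0 := sub_ne_zero.mpr hαγ
  have h3 : β - γ ≠ 0 := sub_ne_zero.mpr hβγ
  have e1 : β - α = -(α - β) := by ring
  have e2 : γ - α = -(α - γ) := by ring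
  have e3 : γ - β = -(β - γ) := by ring
  obtain ⟨A, hA⟩ : ∃ A, A = P / ((α - β) * (α - γ)) := ⟨_, rfl⟩
  obtain ⟨B, hB⟩ : ∃ B, B = Q / ((β - α) * (β - γ)) := ⟨_, rfl⟩
  obtain ⟨C, hC⟩ : ∃ C, C = R / ((γ - α) * (γ - β)) := ⟨_, rfl⟩
  have b0 : V 0 = A + B + C := by
    rw [hA, hB, hC, hP, hQ, hR, e1, e2, e3]
    field_simp
    ring
  have b1 : V 1 = A * α + B * β + C * γ := by
    rw [hA, hB, hC, hP, hQ, hR, e1, e2, e3]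
    field_simp
    ring
  have b2 : V 2 = A * α ^ 2 + B * β ^ 2 + C * γ ^ 2 := by
    rw [hA, hB, hC, hP, hQ, hR, e1, e2, e3]
    field_simp
    ring
  have key : ∀ n : ℕ, V n = A * α ^ n + B * β ^ n + C * γ ^ n ∧
      V (n + 1) = A * α ^ (n + 1) + B * β ^ (n + 1) + C * γ ^ (n + 1) ∧
      V (n + 2) = A * α ^ (n + 2) + B * β ^ (n + 2) + C * γ ^ (n + 2) := by
    intro n
    induction n with
    | zero => simpa using ⟨b0, b1, b2⟩
    | succ k ih =>
      obtain ⟨i0, i1, i2⟩ := ih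
      have h := hV (k + 3)
      rw [show (k : ℤ) + 3 - 1 = k + 2 by ring, show (k : ℤ) + 3 - 2 = k + 1 by ring,
        show (k : ℤ) + 3 - 3 = k by ring, i0, i1, i2] at h
      push_cast
      rw [show (k : ℤ) + 1 + 1 = k + 2 by ring, show (k : ℤ) + 1 + 2 = k + 3 by ring]
      refine ⟨i1, i2, ?_⟩
      rw [h]
      linear_combination (-A * α ^ k) * hα - B * β ^ k * hβ - C * γ ^ k * hγ
  intro n
  have bin : ∀ x : ℂ, (1 + x) ^ n = ∑ i ∈ Finset.range (n + 1), (n.choose i : ℂ) * x ^ i := by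
    intro x
    rw [add_comm, add_pow]
    refine Finset.sum_congr rfl fun i _ => ?_
    rw [one_pow]
    ring
  rw [mul_div_right_comm, mul_div_right_comm, mul_div_right_comm, ← hA, ← hB, ← hC,
    bin, bin, bin, Finset.mul_sum, Finset.mul_sum, Finset.mul_sum,
    ← Finset.sum_add_distrib, ← Finset.sum_add_distrib]
  refine Finset.sum_congr rfl fun i _ => ?_
  rw [(key i).1]
  ring
end
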